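/- arXiv:2306.03151 — 2 statements merged into one kernel-verified Lean document; each statement's English description precedes it below -/
import Mathlib

section
/- (Claim 4: exact variance of k-DISCount) With F̂(S) the k-DISCount estimator based on n i.i.d. samples from ḡ_Ω, p(S) = G(S)/G(Ω), and r = 1 − p(S), Var(F̂(S)) = G(S)² · σ²(S) · (1 − r^n) · E[1/n(S) | n(S) > 0] + F(S)² · r^n · (1 − r^n). -/
open Finset Filter

noncomputable section

variable {Ω : Type*} [Fintype Ω] [DecidableEq Ω]

/-- Expectation of `X : (Fin n → Ω) → ℝ` under `n` i.i.d. samples drawn from the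
pmf `q` on the finite type `Ω` (the `n`-fold product measure). -/
noncomputable def iidExp (n : ℕ) (q : Ω → ℝ) (X : (Fin n → Ω) → ℝ) : ℝ :=
  ∑ v : Fin n → Ω, (∏ i, q (v i)) * X v

/-- Probability of the event `P` under `n` i.i.d. samples drawn from the pmf `q`. -/
noncomputable def iidPr (n : ℕ) (q : Ω → ℝ) (P : (Fin n → Ω) → Prop) [DecidablePred P] : ℝ :=
  iidExp n q fun v => if P v then 1 else 0

/-- Variance of `X` under `n` i.i.d. samples drawn from the pmf `q`. -/
noncomputable def iidVar (n : ℕ) (q : Ω → ℝ) (X : (Fin n → Ω) → ℝ) : ℝ :=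
  iidExp n q fun v => (X v - iidExp n q X) ^ 2

/-- `n(S)`: the number of the samples `v 0, …, v (n-1)` that land in `S`. -/
def nIn (S : Finset Ω) {n : ℕ} (v : Fin n → Ω) : ℕ :=
  (Finset.univ.filter fun i => v i ∈ S).card

/-- The `k`-DISCount estimator `F̂(S)`: equal to
`G(S) · (1/n(S)) · ∑_{i : sᵢ ∈ S} f(sᵢ)/g(sᵢ)` if `n(S) > 0`, and `0` otherwise. -/
noncomputable def kdis (S : Finset Ω) (f g : Ω → ℝ) {n : ℕ} (v : Fin n → Ω) : ℝ :=
  if 0 < nIn S v then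
    (∑ s ∈ S, g s) *
      ((nIn S v : ℝ)⁻¹ * ∑ i ∈ Finset.univ.filter (fun i => v i ∈ S), f (v i) / g (v i))
  else 0

lemma iidExp_add {α : Type*} [Fintype α] (n : ℕ) (q : α → ℝ) (X Y : (Fin n → α) → ℝ) :
    iidExp n q (fun v => X v + Y v) = iidExp n q X + iidExp n q Y := by
  simp only [iidExp, mul_add, Finset.sum_add_distrib]

lemma iidExp_const_mul {α : Type*} [Fintype α] (n : ℕ) (q : α → ℝ) (c : ℝ) (X : (Fin n → α) → ℝ) :
    iidExp n q (fun v => c * X v) = c * iidExp n q X := by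
  simp only [iidExp, Finset.mul_sum]
  exact Finset.sum_congr rfl fun v _ => by ring

lemma iidExp_sum {α : Type*} [Fintype α] {ι : Type*} (t : Finset ι) (n : ℕ) (q : α → ℝ)
    (X : ι → (Fin n → α) → ℝ) :
    iidExp n q (fun v => ∑ i ∈ t, X i v) = ∑ i ∈ t, iidExp n q (X i) := by
  simp only [iidExp, Finset.mul_sum]
  exact Finset.sum_comm

lemma iidExp_const {α : Type*} [Fintype α] (n : ℕ) (q : α → ℝ) (hq : ∑ s, q s = 1) (c : ℝ) :
    iidExp n q (fun _ => c) = c := by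
  rw [iidExp, ← Finset.sum_mul, ← Fintype.sum_pow, hq, one_pow, one_mul]

lemma iidVar_eq_sub {α : Type*} [Fintype α] (n : ℕ) (q : α → ℝ) (hq : ∑ s, q s = 1)
    (X : (Fin n → α) → ℝ) :
    iidVar n q X = iidExp n q (fun v => X v ^ 2) - iidExp n q X ^ 2 := by
  unfold iidVar
  generalize hm : iidExp n q X = m
  have h : (fun v => (X v - m) ^ 2) = fun v => X v ^ 2 + ((-2 * m) * X v + m ^ 2) := by
    funext v; ring
  rw [h, iidExp_add, iidExp_add, iidExp_const_mul, iidExp_const n q hq, hm]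
  ring

/-- If `φ` is supported on `S` and has mean zero, and `W` does not change when the `i`-th sample
moves within `S`, then `W` and `φ (v i)` are uncorrelated. -/
lemma iidExp_mul_apply_eq_zero {n : ℕ} (q : Ω → ℝ) (S : Finset Ω) (i : Fin n)
    (W : (Fin n → Ω) → ℝ) (φ : Ω → ℝ)
    (hW : ∀ v, ∀ a ∈ S, v i ∈ S → W (Function.update v i a) = W v)
    (hφS : ∀ s ∉ S, φ s = 0) (hφ : ∑ s, q s * φ s = 0) :
    iidExp n q (fun v => W v * φ (v i)) = 0 := by
  cases n with
  | zero => exact i.elim0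
  | succ m =>
    rw [iidExp, ← (Fin.insertNthEquiv (fun _ => Ω) i).sum_comp, Fintype.sum_prod_type_right]
    refine Finset.sum_eq_zero fun w _ => ?_
    rcases S.eq_empty_or_nonempty with rfl | ⟨a, ha⟩
    · exact Finset.sum_eq_zero fun s _ => by simp [hφS]
    have key : ∀ s : Ω, W (i.insertNth s w) * φ s = W (i.insertNth a w) * φ s := by
      intro s
      by_cases hs : s ∈ S
      · have := hW (i.insertNth s w) a ha (by simpa using hs)
        rw [Fin.update_insertNth] at this
        rw [this]
      · simp [hφS s hs]
    calc _ = ∑ s, ((∏ j, q (w j)) * W (i.insertNth a w)) * (q s * φ s) := by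
          refine Finset.sum_congr rfl fun s _ => ?_
          simp only [Fin.insertNthEquiv_apply, Fin.insertNth_apply_same,
            Fin.prod_univ_succAbove _ i, Fin.insertNth_apply_succAbove]
          change _ * (W (i.insertNth s w) * φ s) = _
          rw [key]
          ring
      _ = 0 := by rw [← Finset.mul_sum, hφ, mul_zero]

lemma nIn_update {α : Type*} [DecidableEq α] (S : Finset α) {n : ℕ} (v : Fin n → α)
    (i : Fin n) (a : α)
    (ha : a ∈ S) (hv : v i ∈ S) : nIn S (Function.update v i a) = nIn S v := by
  unfold nIn
  congr 1
  refine Finset.filter_congr fun j _ => ?_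
  by_cases h : j = i
  · subst h; simp [ha, hv]
  · simp [h]

lemma cast_nIn {α : Type*} [DecidableEq α] (S : Finset α) {n : ℕ} (v : Fin n → α) :
    (nIn S v : ℝ) = ∑ i, if v i ∈ S then 1 else 0 := by
  simp [nIn]

lemma iidPr_nIn_pos (S : Finset Ω) (n : ℕ) (q : Ω → ℝ) (hq : ∑ s, q s = 1) :
    iidPr n q (fun v => 0 < nIn S v) = 1 - (1 - ∑ s ∈ S, q s) ^ n := by
  have h0 : iidExp n q (fun v => if 0 < nIn S v then 0 else 1) = (1 - ∑ s ∈ S, q s) ^ n := by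
    have : 1 - ∑ s ∈ S, q s = ∑ s, if s ∈ S then 0 else q s := by
      rw [← hq, ← Finset.sum_filter_add_sum_filter_not univ (· ∈ S) q]
      simp [Finset.sum_ite]
    rw [this, Fintype.sum_pow]
    refine Finset.sum_congr rfl fun v _ => ?_
    beta_reduce
    by_cases h : 0 < nIn S v
    · obtain ⟨i, hi⟩ := Finset.card_pos.mp h
      rw [if_pos h, mul_zero, Finset.prod_eq_zero (Finset.mem_univ i)]
      simpa using fun h' => absurd (Finset.mem_filter.mp hi).2 h'
    · rw [if_neg h, mul_one]
      have h' : ∀ i, v i ∉ S := by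
        simpa [nIn, Finset.filter_eq_empty_iff] using h
      exact Finset.prod_congr rfl fun i _ => by simp [h' i]
  have h1 := iidExp_const n q hq 1
  have h2 : (fun _ : Fin n → Ω => (1 : ℝ)) =
      fun v => (if 0 < nIn S v then 1 else 0) + (if 0 < nIn S v then 0 else 1) := by
    funext v; split_ifs <;> norm_num
  rw [h2, iidExp_add, h0] at h1
  unfold iidPr
  linarith

lemma iidExp_nIn_mul_sum (S : Finset Ω) (n : ℕ) (q y : Ω → ℝ)
    (hyS : ∀ s ∉ S, y s = 0) (hy : ∑ s, q s * y s = 0) (c : ℕ → ℝ) :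
    iidExp n q (fun v => c (nIn S v) * ∑ i, y (v i)) = 0 := by
  simp only [Finset.mul_sum]
  rw [iidExp_sum]
  refine Finset.sum_eq_zero fun i _ => ?_
  exact iidExp_mul_apply_eq_zero q S i (fun v => c (nIn S v)) y
    (fun v a ha hv => by simp only [nIn_update S v i a ha hv]) hyS hy

lemma iidExp_nIn_mul_sum_sq (S : Finset Ω) (n : ℕ) (q y : Ω → ℝ)
    (hyS : ∀ s ∉ S, y s = 0) (hy : ∑ s, q s * y s = 0) (τ : ℝ)
    (hτ : ∑ s, q s * y s ^ 2 = (∑ s ∈ S, q s) * τ) (c : ℕ → ℝ) :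
    iidExp n q (fun v => c (nIn S v) * (∑ i, y (v i)) ^ 2) =
      τ * iidExp n q (fun v => c (nIn S v) * nIn S v) := by
  have cross : ∀ i j : Fin n, i ≠ j →
      iidExp n q (fun v => c (nIn S v) * (y (v i) * y (v j))) = 0 := by
    intro i j hij
    have := iidExp_mul_apply_eq_zero q S j (fun v => c (nIn S v) * y (v i)) y
      (fun v a ha hv => by
        simp only [nIn_update S v j a ha hv, Function.update_of_ne hij]) hyS hy
    simpa only [mul_assoc] using this
  have diag : ∀ i : Fin n, iidExp n q (fun v => c (nIn S v) * (y (v i) * y (v i))) =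
      τ * iidExp n q (fun v => c (nIn S v) * if v i ∈ S then 1 else 0) := by
    intro i
    have := iidExp_mul_apply_eq_zero q S i (fun v => c (nIn S v))
      (fun s => y s ^ 2 + (-τ) * if s ∈ S then 1 else 0)
      (fun v a ha hv => by simp only [nIn_update S v i a ha hv])
      (fun s hs => by simp [hyS s hs, hs])
      (by
        simp only [mul_add, Finset.sum_add_distrib, hτ]
        simp [Finset.sum_mul])
    have e : (fun v : Fin n → Ω => c (nIn S v) *
        (y (v i) ^ 2 + (-τ) * if v i ∈ S then 1 else 0)) = fun v =>
        c (nIn S v) * (y (v i) * y (v i)) +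
          (-τ) * (c (nIn S v) * if v i ∈ S then 1 else 0) := by
      funext v; ring
    rw [e, iidExp_add, iidExp_const_mul] at this
    linarith
  have hN : (fun v : Fin n → Ω => c (nIn S v) * (nIn S v : ℝ)) =
      fun v => ∑ i, c (nIn S v) * if v i ∈ S then 1 else 0 := by
    funext v; rw [← Finset.mul_sum, ← cast_nIn]
  simp only [sq, Finset.sum_mul_sum]
  simp only [Finset.mul_sum]
  rw [hN, iidExp_sum, iidExp_sum, Finset.mul_sum]
  refine Finset.sum_congr rfl fun i _ => ?_
  rw [iidExp_sum, Finset.sum_eq_single i (fun j _ hj => cross i j hj.symm) (by simp), diag]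

/-- The estimator is its conditional mean on `n(S) > 0` plus a weighted sum of centred terms. -/
lemma kdis_eq {α : Type*} [DecidableEq α] (S : Finset α) (f g : α → ℝ) {n : ℕ} (v : Fin n → α)
    (hG : ∑ s ∈ S, g s ≠ 0) :
    kdis S f g v = (∑ s ∈ S, f s) * (if 0 < nIn S v then 1 else 0) +
      (∑ s ∈ S, g s) * ((nIn S v : ℝ)⁻¹ *
        ∑ i, if v i ∈ S then f (v i) / g (v i) - (∑ t ∈ S, f t) / ∑ t ∈ S, g t else 0) := by
  unfold kdis
  split_ifs with h
  · have hN : (nIn S v : ℝ) ≠ 0 := by exact_mod_cast h.ne'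
    rw [← Finset.sum_filter, Finset.sum_sub_distrib, Finset.sum_const, nsmul_eq_mul]
    change _ = _ + _ * (_ * (_ - (nIn S v : ℝ) * _))
    field_simp
    ring
  · have : nIn S v = 0 := by omega
    simp [this]

/-- **Claim 4: exact variance of k-DISCount.**
With `F̂(S)` the k-DISCount estimator based on `n` i.i.d. samples from `ḡ_Ω`,
`p(S) = G(S)/G(Ω)` and `r = 1 − p(S)`:
`Var(F̂(S)) = G(S)² σ²(S) (1 − rⁿ) E[1/n(S) | n(S) > 0] + F(S)² rⁿ (1 − rⁿ)`. -/
theorem kdiscount_exact_variance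
    (S : Finset Ω) (hS : S.Nonempty) (f g : Ω → ℝ)
    (hf : ∀ s, 0 ≤ f s) (hg : ∀ s, 0 < g s)
    (n : ℕ) (q : Ω → ℝ) (hq : q = fun s => g s / ∑ t, g t)
    (r : ℝ) (hr : r = 1 - (∑ s ∈ S, g s) / ∑ s, g s)
    (σ2 : ℝ)
    (hσ2 : σ2 = ∑ s ∈ S, (g s / ∑ t ∈ S, g t) *
        (f s / g s - (∑ t ∈ S, f t) / ∑ t ∈ S, g t) ^ 2) :
    iidVar n q (fun v => kdis S f g v)
      = (∑ s ∈ S, g s) ^ 2 * σ2 * (1 - r ^ n) *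
          (iidExp n q (fun v => ((nIn S v : ℝ))⁻¹ * if 0 < nIn S v then 1 else 0) /
            iidPr n q (fun v => 0 < nIn S v)) +
        (∑ s ∈ S, f s) ^ 2 * r ^ n * (1 - r ^ n) := by
  have hGS : 0 < ∑ s ∈ S, g s := Finset.sum_pos (fun s _ => hg s) hS
  have hG : 0 < ∑ s, g s :=
    hGS.trans_le (Finset.sum_le_univ_sum_of_nonneg fun s => (hg s).le)
  have hq1 : ∑ s, q s = 1 := by
    rw [hq, ← Finset.sum_div, div_self hG.ne']
  have hqS : ∑ s ∈ S, q s = (∑ s ∈ S, g s) / ∑ s, g s := by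
    rw [hq, ← Finset.sum_div]
  have hPr : iidPr n q (fun v => 0 < nIn S v) = 1 - r ^ n := by
    rw [iidPr_nIn_pos S n q hq1, hqS, hr]
  set y : Ω → ℝ := fun s =>
    if s ∈ S then f s / g s - (∑ t ∈ S, f t) / ∑ t ∈ S, g t else 0 with hydef
  have hyS : ∀ s ∉ S, y s = 0 := fun s hs => by simp [hydef, hs]
  have hy : ∑ s, q s * y s = 0 := by
    have e : ∀ s, q s * y s = if s ∈ S then
        (f s - g s * ((∑ t ∈ S, f t) / ∑ t ∈ S, g t)) / ∑ t, g t else 0 := by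
      intro s
      have := (hg s).ne'
      simp only [hq, hydef]
      split_ifs
      · field_simp
      · simp
    simp only [e]
    rw [← Finset.sum_filter, Finset.filter_univ_mem, ← Finset.sum_div,
      Finset.sum_sub_distrib, ← Finset.sum_mul, mul_div_cancel₀ _ hGS.ne', sub_self, zero_div]
  have hτ : ∑ s, q s * y s ^ 2 = (∑ s ∈ S, q s) * σ2 := by
    have e : ∀ s, q s * y s ^ 2 = if s ∈ S then
        q s * (f s / g s - (∑ t ∈ S, f t) / ∑ t ∈ S, g t) ^ 2 else 0 := by
      intro s
      simp only [hydef]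
      split_ifs <;> simp
    simp only [e]
    rw [← Finset.sum_filter, Finset.filter_univ_mem, hqS, hσ2, Finset.mul_sum]
    refine Finset.sum_congr rfl fun s _ => ?_
    rw [hq, ← mul_assoc]
    congr 1
    field_simp
  have hX : (fun v : Fin n → Ω => kdis S f g v) = fun v =>
      (∑ s ∈ S, f s) * (if 0 < nIn S v then 1 else 0) +
        (∑ s ∈ S, g s) * ((nIn S v : ℝ)⁻¹ * ∑ i, y (v i)) :=
    funext fun v => kdis_eq S f g v hGS.ne'
  have hX2 : (fun v : Fin n → Ω => kdis S f g v ^ 2) = fun v =>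
      (∑ s ∈ S, f s) ^ 2 * (if 0 < nIn S v then 1 else 0) +
        ((2 * (∑ s ∈ S, f s) * ∑ s ∈ S, g s) * ((nIn S v : ℝ)⁻¹ * ∑ i, y (v i)) +
          (∑ s ∈ S, g s) ^ 2 * (((nIn S v : ℝ)⁻¹) ^ 2 * (∑ i, y (v i)) ^ 2)) := by
    funext v
    rw [congrFun hX v]
    split_ifs with h
    · ring
    · have : nIn S v = 0 := by omega
      simp [this]
  have hI : iidExp n q (fun v => if 0 < nIn S v then 1 else 0) = 1 - r ^ n := hPr
  have hlin := iidExp_nIn_mul_sum S n q y hyS hy (fun k => (k : ℝ)⁻¹)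
  have hsq := iidExp_nIn_mul_sum_sq S n q y hyS hy σ2 hτ (fun k => ((k : ℝ)⁻¹) ^ 2)
  have hinv : (fun v : Fin n → Ω => ((nIn S v : ℝ)⁻¹) ^ 2 * nIn S v) =
      fun v => (nIn S v : ℝ)⁻¹ * if 0 < nIn S v then 1 else 0 := by
    funext v
    split_ifs with h
    · have hN : (nIn S v : ℝ) ≠ 0 := by exact_mod_cast h.ne'
      field_simp
    · have : nIn S v = 0 := by omega
      simp [this]
  rw [hinv] at hsq
  have hcancel : (1 - r ^ n) *
      (iidExp n q (fun v => ((nIn S v : ℝ))⁻¹ * if 0 < nIn S v then 1 else 0) / (1 - r ^ n)) =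
      iidExp n q (fun v => ((nIn S v : ℝ))⁻¹ * if 0 < nIn S v then 1 else 0) := by
    rcases Nat.eq_zero_or_pos n with rfl | hn
    · simp [iidExp, nIn]
    · refine mul_div_cancel₀ _ (sub_pos.mpr (pow_lt_one₀ ?_ ?_ hn.ne')).ne'
      · rw [hr, sub_nonneg, div_le_one hG]
        exact Finset.sum_le_univ_sum_of_nonneg fun s => (hg s).le
      · rw [hr]
        linarith [div_pos hGS hG]
  rw [iidVar_eq_sub n q hq1, hX2, hX, hPr, mul_assoc (_ * σ2), hcancel]
  simp only [iidExp_add, iidExp_const_mul]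
  rw [hI, hlin, hsq]
  ring
end
end

section
/- (Bias decays exponentially) With p(S) = G(S)/G(Ω) ∈ (0, 1) and r = 1 − p(S), the magnitude of the k-DISCount bias |E[F̂_n(S)] − F(S)| = F(S) · r^n tends to 0 as n → ∞, and moreover n · r^n → 0 as n → ∞. -/
open Finset Filter

noncomputable section

variable {Ω : Type*} [Fintype Ω] [DecidableEq Ω]

/-- The number of samples in `S` splits into the contribution of one sample and that of the rest. -/
lemma nIn_insertNth {α : Type*} [DecidableEq α] (S : Finset α) {m : ℕ} (i : Fin (m + 1))
    (s : α) (w : Fin m → α) :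
    nIn S (i.insertNth s w : Fin (m + 1) → α) = (if s ∈ S then 1 else 0) + nIn S w := by
  simp only [nIn, Finset.card_filter]
  rw [Fin.sum_univ_succAbove _ i]
  simp

/-- The event that no sample lands in `S` has probability `(∑ s ∈ Sᶜ, q s) ^ n`. -/
lemma iidExp_nIn_eq_zero (S : Finset Ω) (n : ℕ) (q : Ω → ℝ) :
    iidExp n q (fun v => if nIn S v = 0 then 1 else 0) = (∑ s ∈ Sᶜ, q s) ^ n := by
  have h : ∑ s ∈ Sᶜ, q s = ∑ s, if s ∉ S then q s else 0 := by
    rw [← Finset.sum_filter]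
    congr 1
    ext s
    simp
  rw [h, Fintype.sum_pow, iidExp]
  refine Finset.sum_congr rfl fun v _ => ?_
  by_cases hv : nIn S v = 0
  · have hv' : ∀ i, v i ∉ S := by simpa [nIn, Finset.filter_eq_empty_iff] using hv
    simp [hv, hv']
  · obtain ⟨i, hi⟩ : ∃ i, v i ∈ S := by
      simpa [nIn, Finset.filter_eq_empty_iff] using hv
    rw [if_neg hv, mul_zero, Finset.prod_eq_zero (Finset.mem_univ i) (by simp [hi])]

/-- The expected contribution of the `i`-th sample to the average of `h` over samples in `S`. -/
lemma iidExp_inv_nIn_mul_apply (S : Finset Ω) (m : ℕ) (q h : Ω → ℝ) (i : Fin (m + 1)) :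
    iidExp (m + 1) q (fun v => (nIn S v : ℝ)⁻¹ * if v i ∈ S then h (v i) else 0) =
      (∑ s ∈ S, q s * h s) * iidExp m q fun w => (1 + nIn S w : ℝ)⁻¹ := by
  simp only [iidExp]
  rw [← (Fin.insertNthEquiv (fun _ => Ω) i).sum_comp, Fintype.sum_prod_type,
    Finset.sum_mul_sum, ← Finset.sum_subset (Finset.subset_univ S)]
  · refine Finset.sum_congr rfl fun s hs => Finset.sum_congr rfl fun w _ => ?_
    have hv : Fin.insertNthEquiv (fun _ => Ω) i (s, w) = i.insertNth s w := rfl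
    rw [hv, nIn_insertNth, Fin.prod_univ_succAbove _ i]
    simp [hs]
    ring
  · intro s _ hs
    simp [hs]

/-- The expected average of `h` over the samples in `S` (zero if there are none) depends on `h`
only through `∑ s ∈ S, q s * h s`. -/
lemma iidExp_inv_nIn_mul_sum (S : Finset Ω) (m : ℕ) (q h : Ω → ℝ) :
    iidExp (m + 1) q (fun v => (nIn S v : ℝ)⁻¹ *
        ∑ i ∈ Finset.univ.filter (fun i => v i ∈ S), h (v i)) =
      (∑ s ∈ S, q s * h s) * ((m + 1) * iidExp m q fun w => (1 + nIn S w : ℝ)⁻¹) := by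
  have hsum := Finset.sum_congr rfl fun i (_ : i ∈ Finset.univ) =>
    iidExp_inv_nIn_mul_apply S m q h i
  rw [Finset.sum_const, Finset.card_univ, Fintype.card_fin, nsmul_eq_mul] at hsum
  push_cast at hsum
  rw [mul_left_comm, ← hsum]
  simp only [iidExp]
  rw [Finset.sum_comm]
  refine Finset.sum_congr rfl fun v _ => ?_
  rw [Finset.sum_filter, Finset.mul_sum, Finset.mul_sum]

/-- The expected average of `h` over the samples in `S`, for a probability mass function `q`. -/
lemma sum_mul_iidExp_inv_nIn_mul_sum (S : Finset Ω) (n : ℕ) (q h : Ω → ℝ) (hq : ∑ s, q s = 1) :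
    (∑ s ∈ S, q s) * iidExp n q (fun v => (nIn S v : ℝ)⁻¹ *
        ∑ i ∈ Finset.univ.filter (fun i => v i ∈ S), h (v i)) =
      (∑ s ∈ S, q s * h s) * (1 - (1 - ∑ s ∈ S, q s) ^ n) := by
  cases n with
  | zero => simp [iidExp]
  | succ m =>
    have hone := iidExp_inv_nIn_mul_sum S m q fun _ => 1
    have hcompl : ∑ s ∈ Sᶜ, q s = 1 - ∑ s ∈ S, q s := by
      rw [← hq, ← Finset.sum_add_sum_compl S q]
      ring
    have htotal : ∑ v : Fin (m + 1) → Ω, ∏ i, q (v i) = 1 := by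
      rw [← Fintype.sum_pow, hq, one_pow]
    have hpos : iidExp (m + 1) q (fun v => (nIn S v : ℝ)⁻¹ *
        ∑ i ∈ Finset.univ.filter (fun i => v i ∈ S), (1 : ℝ)) =
        1 - (1 - ∑ s ∈ S, q s) ^ (m + 1) := by
      rw [← hcompl, ← iidExp_nIn_eq_zero, eq_sub_iff_add_eq]
      simp only [iidExp]
      rw [← Finset.sum_add_distrib]
      refine Eq.trans ?_ htotal
      refine Finset.sum_congr rfl fun v _ => ?_
      rw [← mul_add, Finset.sum_const, nsmul_one, ← nIn]
      by_cases hv : nIn S v = 0 <;> simp [hv]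
    rw [iidExp_inv_nIn_mul_sum, ← hpos, hone]
    simp only [mul_one]
    ring

/-- The exact expectation of the `k`-DISCount estimator. -/
lemma iidExp_kdis (S : Finset Ω) (hS : S.Nonempty) (f g : Ω → ℝ) (hg : ∀ s, 0 < g s) (n : ℕ) :
    iidExp n (fun s => g s / ∑ t, g t) (fun v => kdis S f g v) =
      (∑ s ∈ S, f s) * (1 - (1 - (∑ s ∈ S, g s) / ∑ s, g s) ^ n) := by
  have hG : 0 < ∑ s, g s :=
    Finset.sum_pos (fun s _ => hg s) (hS.mono (Finset.subset_univ S))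
  have hmean := sum_mul_iidExp_inv_nIn_mul_sum S n (fun s => g s / ∑ t, g t)
    (fun s => f s / g s) (by rw [← Finset.sum_div, div_self hG.ne'])
  have hfg : ∑ s ∈ S, g s / (∑ t, g t) * (f s / g s) = (∑ s ∈ S, f s) / ∑ t, g t := by
    rw [Finset.sum_div]
    refine Finset.sum_congr rfl fun s _ => ?_
    have := (hg s).ne'
    field_simp
  rw [hfg, ← Finset.sum_div, div_mul_eq_mul_div, div_mul_eq_mul_div,
    div_left_inj' hG.ne'] at hmean
  rw [← hmean]
  simp only [iidExp]
  rw [Finset.mul_sum]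
  refine Finset.sum_congr rfl fun v _ => ?_
  rw [kdis]
  split_ifs with hv
  · ring
  · simp [Nat.eq_zero_of_not_pos hv]

/-- **Bias decays exponentially.**
With `p(S) = G(S)/G(Ω) ∈ (0,1)` and `r = 1 − p(S)`, the magnitude of the
k-DISCount bias satisfies `|E[F̂ₙ(S)] − F(S)| = F(S) · rⁿ`, which tends to `0`
as `n → ∞`; moreover `n · rⁿ → 0` as `n → ∞`. -/
theorem kdiscount_bias_decays
    (S : Finset Ω) (hS : S.Nonempty) (hSne : S ≠ Finset.univ)
    (f g : Ω → ℝ) (hf : ∀ s, 0 ≤ f s) (hg : ∀ s, 0 < g s)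
    (q : Ω → ℝ) (hq : q = fun s => g s / ∑ t, g t)
    (p : ℝ) (hp : p = (∑ s ∈ S, g s) / ∑ s, g s) (hp0 : 0 < p) (hp1 : p < 1)
    (r : ℝ) (hr : r = 1 - p) :
    (∀ n : ℕ,
      |iidExp n q (fun v => kdis S f g v) - ∑ s ∈ S, f s| = (∑ s ∈ S, f s) * r ^ n) ∧
    Tendsto (fun n : ℕ => |iidExp n q (fun v => kdis S f g v) - ∑ s ∈ S, f s|)
      atTop (nhds 0) ∧
    Tendsto (fun n : ℕ => (n : ℝ) * r ^ n) atTop (nhds 0) := by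
  subst hq hp hr
  set r := 1 - (∑ s ∈ S, g s) / ∑ s, g s
  have hF : 0 ≤ ∑ s ∈ S, f s := Finset.sum_nonneg fun s _ => hf s
  have hr0 : 0 ≤ r := by linarith
  have hr1 : r < 1 := by linarith
  have hbias : ∀ n : ℕ, |iidExp n (fun s => g s / ∑ t, g t) (fun v => kdis S f g v) -
      ∑ s ∈ S, f s| = (∑ s ∈ S, f s) * r ^ n := fun n => by
    rw [iidExp_kdis S hS f g hg n, mul_one_sub, sub_sub_cancel_left, abs_neg,
      abs_of_nonneg (mul_nonneg hF (pow_nonneg hr0 n))]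
  refine ⟨hbias, ?_, tendsto_self_mul_const_pow_of_lt_one hr0 hr1⟩
  simp only [hbias]
  simpa using (tendsto_pow_atTop_nhds_zero_of_lt_one hr0 hr1).const_mul (∑ s ∈ S, f s)
end
end
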